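/- arXiv:math/9912229 — 2 statements merged into one kernel-verified Lean document; each statement's English description precedes it below -/
import Mathlib

section
/- Let V be a finite-dimensional real vector space, σ a convex polyhedral cone in V, W a linear subspace of V with W ⊆ σ ∩ (−σ), and P : V → V/W the canonical projection. Then τ ↦ P(τ) is a bijection from the set of faces of σ onto the set of faces of P(σ), and it is inverse to the map τ̃ ↦ P⁻¹(τ̃) ∩ σ. -/
open scoped Pointwise

/-- A (not necessarily strictly) convex cone, as a subset of a real vector space:
it contains `0` and is closed under addition and under scaling by nonnegative reals. -/
def IsConeSet {V : Type*} [AddCommGroup V] [Module ℝ V] (τ : Set V) : Prop :=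
  (0 : V) ∈ τ ∧ (∀ x ∈ τ, ∀ y ∈ τ, x + y ∈ τ) ∧ ∀ c : ℝ, 0 ≤ c → ∀ x ∈ τ, c • x ∈ τ

/-- `τ` is a face of the convex cone `σ`: a convex subcone such that whenever the sum of
two elements of `σ` lies in `τ`, both elements lie in `τ`. -/
def IsFaceOf {V : Type*} [AddCommGroup V] [Module ℝ V] (τ σ : Set V) : Prop :=
  IsConeSet τ ∧ τ ⊆ σ ∧ ∀ x ∈ σ, ∀ y ∈ σ, x + y ∈ τ → x ∈ τ ∧ y ∈ τ

/-- A convex polyhedral cone in a real vector space: the set of all nonnegative linear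
combinations of finitely many vectors. -/
def IsPolyCone {V : Type*} [AddCommGroup V] [Module ℝ V] (σ : Set V) : Prop :=
  ∃ (m : ℕ) (g : Fin m → V),
    σ = { x | ∃ c : Fin m → ℝ, (∀ k, 0 ≤ c k) ∧ x = ∑ k, c k • g k }

/-- The smallest face of the cone `σ` containing the subset `A ⊆ σ`. -/
def minFaceContaining {V : Type*} [AddCommGroup V] [Module ℝ V] (σ A : Set V) : Set V :=
  ⋂₀ { τ | IsFaceOf τ σ ∧ A ⊆ τ }

theorem IsPolyCone.isConeSet {V : Type*} [AddCommGroup V] [Module ℝ V] {σ : Set V}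
    (hσ : IsPolyCone σ) : IsConeSet σ := by
  obtain ⟨m, g, rfl⟩ := hσ
  refine ⟨⟨0, fun _ => le_rfl, by simp⟩, ?_, ?_⟩
  · rintro _ ⟨c, hc, rfl⟩ _ ⟨d, hd, rfl⟩
    exact ⟨c + d, fun k => add_nonneg (hc k) (hd k), by
      simp [add_smul, Finset.sum_add_distrib]⟩
  · rintro a ha _ ⟨c, hc, rfl⟩
    exact ⟨fun k => a * c k, fun k => mul_nonneg ha (hc k), by
      simp [mul_smul, Finset.smul_sum]⟩

theorem IsConeSet.image {V V' : Type*} [AddCommGroup V] [Module ℝ V] [AddCommGroup V']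
    [Module ℝ V'] {τ : Set V} (hτ : IsConeSet τ) (f : V →ₗ[ℝ] V') : IsConeSet (f '' τ) := by
  refine ⟨⟨0, hτ.1, map_zero f⟩, ?_, ?_⟩
  · rintro _ ⟨x, hx, rfl⟩ _ ⟨y, hy, rfl⟩
    exact ⟨x + y, hτ.2.1 x hx y hy, map_add f x y⟩
  · rintro c hc _ ⟨x, hx, rfl⟩
    exact ⟨c • x, hτ.2.2 c hc x hx, map_smul f c x⟩

/-- Every face of `σ` contains the lineality space of `σ`. -/
theorem IsFaceOf.inter_neg_subset {V : Type*} [AddCommGroup V] [Module ℝ V] {τ σ : Set V}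
    (hτ : IsFaceOf τ σ) : σ ∩ (-σ) ⊆ τ :=
  fun w hw => (hτ.2.2 w hw.1 (-w) hw.2 (by simpa using hτ.1.1)).1

/-- A cone containing the subspace `W` is saturated for the projection modulo `W`. -/
theorem IsConeSet.mkQ_mem_image_iff {V : Type*} [AddCommGroup V] [Module ℝ V] {τ : Set V}
    (hτ : IsConeSet τ) {W : Submodule ℝ V} (hW : (W : Set V) ⊆ τ) {x : V} :
    W.mkQ x ∈ W.mkQ '' τ ↔ x ∈ τ := by
  refine ⟨?_, Set.mem_image_of_mem _⟩
  rintro ⟨y, hy, hyx⟩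
  have h : x - y ∈ W := (Submodule.Quotient.eq W).1 hyx.symm
  simpa using hτ.2.1 y hy _ (hW h)

theorem IsFaceOf.image_mkQ {V : Type*} [AddCommGroup V] [Module ℝ V] {τ σ : Set V}
    (hτ : IsFaceOf τ σ) {W : Submodule ℝ V} (hW : (W : Set V) ⊆ τ) :
    IsFaceOf (W.mkQ '' τ) (W.mkQ '' σ) := by
  refine ⟨hτ.1.image _, Set.image_mono hτ.2.1, ?_⟩
  rintro _ ⟨x, hx, rfl⟩ _ ⟨y, hy, rfl⟩ hxy
  rw [← map_add, hτ.1.mkQ_mem_image_iff hW] at hxy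
  have h := hτ.2.2 x hx y hy hxy
  exact ⟨Set.mem_image_of_mem _ h.1, Set.mem_image_of_mem _ h.2⟩

theorem IsFaceOf.preimage_inter {V V' : Type*} [AddCommGroup V] [Module ℝ V] [AddCommGroup V']
    [Module ℝ V'] {σ : Set V} (hσ : IsConeSet σ) {f : V →ₗ[ℝ] V'} {τ' : Set V'}
    (hτ' : IsFaceOf τ' (f '' σ)) : IsFaceOf (f ⁻¹' τ' ∩ σ) σ := by
  refine ⟨⟨⟨by simpa using hτ'.1.1, hσ.1⟩, ?_, ?_⟩, Set.inter_subset_right, ?_⟩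
  · rintro x ⟨hx, hxσ⟩ y ⟨hy, hyσ⟩
    exact ⟨by simpa using hτ'.1.2.1 _ hx _ hy, hσ.2.1 x hxσ y hyσ⟩
  · rintro c hc x ⟨hx, hxσ⟩
    exact ⟨by simpa using hτ'.1.2.2 c hc _ hx, hσ.2.2 c hc x hxσ⟩
  · rintro x hx y hy ⟨hxy, -⟩
    have h := hτ'.2.2 (f x) ⟨x, hx, rfl⟩ (f y) ⟨y, hy, rfl⟩ (by simpa using hxy)
    exact ⟨⟨h.1, hx⟩, ⟨h.2, hy⟩⟩

/-- **Remark 5.2 (ii).**  If `W ⊆ σ ∩ (−σ)`, then `τ ↦ P(τ)` is a bijection from the set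
of faces of `σ` onto the set of faces of `P(σ)`, inverse to `τ̃ ↦ P⁻¹(τ̃) ∩ σ`. -/
theorem face_image_bijective_of_subspace_le_lineality
    {V : Type*} [AddCommGroup V] [Module ℝ V] [FiniteDimensional ℝ V]
    (σ : Set V) (hσ : IsPolyCone σ) (W : Submodule ℝ V)
    (hW : (W : Set V) ⊆ σ ∩ (-σ)) :
    Set.BijOn (fun τ : Set V => W.mkQ '' τ) { τ | IsFaceOf τ σ }
        { τ' | IsFaceOf τ' (W.mkQ '' σ) } ∧
      (∀ τ : Set V, IsFaceOf τ σ → W.mkQ ⁻¹' (W.mkQ '' τ) ∩ σ = τ) ∧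
      ∀ τ' : Set (V ⧸ W), IsFaceOf τ' (W.mkQ '' σ) → W.mkQ '' (W.mkQ ⁻¹' τ' ∩ σ) = τ' := by
  have left_inv : ∀ τ : Set V, IsFaceOf τ σ → W.mkQ ⁻¹' (W.mkQ '' τ) ∩ σ = τ := by
    intro τ hτ
    ext x
    rw [Set.mem_inter_iff, Set.mem_preimage,
      hτ.1.mkQ_mem_image_iff (hW.trans hτ.inter_neg_subset)]
    exact ⟨And.left, fun hx => ⟨hx, hτ.2.1 hx⟩⟩
  have right_inv : ∀ τ' : Set (V ⧸ W), IsFaceOf τ' (W.mkQ '' σ) →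
      W.mkQ '' (W.mkQ ⁻¹' τ' ∩ σ) = τ' := by
    intro τ' hτ'
    rw [Set.image_preimage_inter, Set.inter_eq_left]
    exact hτ'.2.1
  refine ⟨⟨fun τ hτ => ?_, fun τ₁ h₁ τ₂ h₂ h => ?_, fun τ' hτ' => ?_⟩, left_inv, right_inv⟩
  · exact IsFaceOf.image_mkQ hτ (hW.trans (IsFaceOf.inter_neg_subset hτ))
  · rw [← left_inv τ₁ h₁, ← left_inv τ₂ h₂]
    exact congrArg (fun t => W.mkQ ⁻¹' t ∩ σ) h
  · exact ⟨_, IsFaceOf.preimage_inter hσ.isConeSet hτ', right_inv τ' hτ'⟩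
end

section
/- Let S = (Σ_ij)_{i,j∈I} and S' = (Σ'_ij)_{i,j∈I'} be systems of quasi-fans in lattices N and N' respectively, let F : N → N' be a lattice homomorphism and μ : I → I', i ↦ i', a map such that for all i, j ∈ I and every σ ∈ Σ_ij there is σ' ∈ Σ'_{i'j'} with F_ℝ(σ) ⊆ σ'. Then there is a unique map of systems of quasi-fans (F,𝔣) from S to S' such that 𝔣([σ,i]) ≺ [σ', i'] holds for all i, j ∈ I, all σ ∈ Σ_ij and all σ' ∈ Σ'_{i'j'} with F_ℝ(σ) ⊆ σ'. -/
open scoped TensorProduct Pointwise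

/-- The relative interior of a convex cone (algebraic formulation, which for polyhedral
cones in a finite dimensional space agrees with the topological relative interior). -/
def coneRelint {V : Type*} [AddCommGroup V] [Module ℝ V] (σ : Set V) : Set V :=
  { x | x ∈ σ ∧ ∀ y ∈ σ, ∃ ε : ℝ, 0 < ε ∧ x - ε • y ∈ σ }

/-- The real vector space `N_ℝ = ℝ ⊗_ℤ N` associated to a lattice `N`. -/
abbrev NR (N : Type*) [AddCommGroup N] : Type _ := ℝ ⊗[ℤ] N

/-- The canonical map `N → N_ℝ`, `n ↦ 1 ⊗ n`. -/
noncomputable def toNR {N : Type*} [AddCommGroup N] (n : N) : NR N := (1 : ℝ) ⊗ₜ[ℤ] n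

/-- A rational polyhedral cone in the lattice `N`: a cone in `N_ℝ` generated by finitely
many lattice vectors. -/
def IsRatCone {N : Type*} [AddCommGroup N] (σ : Set (NR N)) : Prop :=
  ∃ (m : ℕ) (v : Fin m → N),
    σ = { x | ∃ c : Fin m → ℝ, (∀ k, 0 ≤ c k) ∧ x = ∑ k, c k • toNR (v k) }

/-- A quasi-fan in the lattice `N`: a finite set of rational polyhedral cones, closed under
passing to faces, in which any two members intersect in a common face of both. -/
def IsQuasiFan {N : Type*} [AddCommGroup N] (Sig : Set (Set (NR N))) : Prop :=
  Sig.Finite ∧ (∀ σ ∈ Sig, IsRatCone σ) ∧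
    (∀ σ ∈ Sig, ∀ τ, IsFaceOf τ σ → τ ∈ Sig) ∧
    ∀ σ ∈ Sig, ∀ σ' ∈ Sig, IsFaceOf (σ ∩ σ') σ ∧ IsFaceOf (σ ∩ σ') σ'

/-- A fan: a quasi-fan all of whose cones are strictly convex. -/
def IsFan {N : Type*} [AddCommGroup N] (Δ : Set (Set (NR N))) : Prop :=
  IsQuasiFan Δ ∧ ∀ σ ∈ Δ, σ ∩ (-σ) = ({0} : Set (NR N))

/-- A system of quasi-fans in the lattice `N`, indexed by `I`. -/
structure SysQFan (N : Type*) [AddCommGroup N] (I : Type*) where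
  D : I → I → Set (Set (NR N))
  isQF : ∀ i j, IsQuasiFan (D i j)
  symm : ∀ i j, D i j = D j i
  inter : ∀ i j k, D i j ∩ D j k ⊆ D i k

namespace SysQFan

variable {N : Type*} [AddCommGroup N] {I : Type*}

/-- A system of fans: a system of quasi-fans all of whose members are fans. -/
def IsFanSys (S : SysQFan N I) : Prop := ∀ i j, IsFan (S.D i j)

/-- An affine system: each `Σ_ii` consists of all the faces of a single cone. -/
def IsAffine (S : SysQFan N I) : Prop := ∀ i, ∃ σ, S.D i i = { τ | IsFaceOf τ σ }

/-- The set `𝔉(S)` of labelled cones of a system of quasi-fans. -/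
def LCone (S : SysQFan N I) := { p : Set (NR N) × I // p.1 ∈ S.D p.2 p.2 }

/-- The glueing relation `(σ,i) ∼ (τ,j) ↔ σ = τ ∧ σ ∈ Σ_ij` on labelled cones. -/
def glueSetoid (S : SysQFan N I) : Setoid (LCone S) where
  r p q := p.1.1 = q.1.1 ∧ p.1.1 ∈ S.D p.1.2 q.1.2
  iseqv := by
    refine ⟨fun p => ⟨rfl, p.2⟩, fun {p q} h => ⟨h.1.symm, ?_⟩,
      fun {p q r} h h' => ⟨h.1.trans h'.1, ?_⟩⟩
    · rw [S.symm, ← h.1]; exact h.2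
    · exact S.inter _ _ _ ⟨h.2, by rw [h.1]; exact h'.2⟩

/-- `Ω(S)`: the set of equivalence classes of labelled cones under the glueing relation. -/
def Omega (S : SysQFan N I) := Quotient (glueSetoid S)

/-- The class `[σ,i] ∈ Ω(S)` of a labelled cone `(σ,i)`. -/
def cls {S : SysQFan N I} (p : LCone S) : Omega S := Quotient.mk (glueSetoid S) p

/-- The partial order on `Ω(S)`:  `[τ,j] ≺ [σ,i]` iff `τ ≺ σ` and `[τ,i] = [τ,j]`. -/
def le (S : SysQFan N I) (a b : Omega S) : Prop :=
  ∃ p q : LCone S, cls p = a ∧ cls q = b ∧ IsFaceOf p.1.1 q.1.1 ∧ p.1.1 ∈ S.D p.1.2 q.1.2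

/-- A map of systems of quasi-fans: a lattice homomorphism `F` together with an order
preserving map `f : Ω(S) → Ω(S')` such that `f [σ,i] = [σ',i']` implies
`F_ℝ(σ°) ⊆ (σ')°`. -/
def IsSysMap {N' : Type*} [AddCommGroup N'] {I' : Type*} (S : SysQFan N I)
    (S' : SysQFan N' I') (F : N →ₗ[ℤ] N') (f : Omega S → Omega S') : Prop :=
  (∀ a b : Omega S, le S a b → le S' (f a) (f b)) ∧
    ∀ (p : LCone S) (q : LCone S'), f (cls p) = cls q →
      (LinearMap.baseChange ℝ F) '' coneRelint p.1.1 ⊆ coneRelint q.1.1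

/-- A single quasi-fan, regarded as a system of quasi-fans with one index. -/
def single {N' : Type*} [AddCommGroup N'] (Δ : Set (Set (NR N'))) (h : IsQuasiFan Δ) :
    SysQFan N' PUnit where
  D _ _ := Δ
  isQF _ _ := h
  symm _ _ := rfl
  inter _ _ _ := fun _ hσ => hσ.1

end SysQFan

/-- A lattice: a finitely generated free `ℤ`-module. -/
structure LatticeData where
  carrier : Type
  [grp : AddCommGroup carrier]
  [free : Module.Free ℤ carrier]
  [fin : Module.Finite ℤ carrier]

attribute [instance] LatticeData.grp LatticeData.free LatticeData.fin

section Cones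

variable {V W : Type*} [AddCommGroup V] [Module ℝ V] [AddCommGroup W] [Module ℝ W]

theorem IsConeSet.of_smul_mem {τ : Set V} (hτ : IsConeSet τ) {ε : ℝ} (hε : 0 < ε) {x : V}
    (hx : ε • x ∈ τ) : x ∈ τ := by
  simpa [smul_smul, inv_mul_cancel₀ hε.ne'] using hτ.2.2 ε⁻¹ (inv_nonneg.2 hε.le) _ hx

/-- A face of a cone that meets the relative interior is the whole cone. -/
theorem IsFaceOf.eq_of_mem_coneRelint {τ σ : Set V} (hτ : IsFaceOf τ σ) (hσ : IsConeSet σ)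
    {y : V} (hyτ : y ∈ τ) (hyσ : y ∈ coneRelint σ) : τ = σ := by
  refine hτ.2.1.antisymm fun z hz => ?_
  obtain ⟨ε, hε, hmem⟩ := hyσ.2 z hz
  exact hτ.1.of_smul_mem hε
    (hτ.2.2 _ (hσ.2.2 ε hε.le z hz) _ hmem (by rwa [add_sub_cancel])).1

/-- The smallest face of the cone `σ` containing the point `y`. -/
def minFace (σ : Set V) (y : V) : Set V :=
  { z | z ∈ σ ∧ ∃ ε : ℝ, 0 < ε ∧ y - ε • z ∈ σ }

theorem isFaceOf_minFace {σ : Set V} (hσ : IsConeSet σ) {y : V} (hy : y ∈ σ) :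
    IsFaceOf (minFace σ y) σ := by
  obtain ⟨h0, hadd, hsmul⟩ := hσ
  refine ⟨⟨⟨h0, 1, one_pos, by simpa using hy⟩, ?_, ?_⟩, fun z hz => hz.1, ?_⟩
  · rintro z ⟨hz, ε, hε, hεz⟩ w ⟨hw, δ, hδ, hδw⟩
    refine ⟨hadd _ hz _ hw, ε * δ / (ε + δ), by positivity, ?_⟩
    have key : y - (ε * δ / (ε + δ)) • (z + w)
        = (δ / (ε + δ)) • (y - ε • z) + (ε / (ε + δ)) • (y - δ • w) := by
      have : (δ / (ε + δ)) + (ε / (ε + δ)) = 1 := by field_simp; ring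
      calc y - (ε * δ / (ε + δ)) • (z + w)
          = ((δ / (ε + δ)) + (ε / (ε + δ))) • y - (ε * δ / (ε + δ)) • (z + w) := by
            rw [this, one_smul]
        _ = _ := by module
    rw [key]
    exact hadd _ (hsmul _ (by positivity) _ hεz) _ (hsmul _ (by positivity) _ hδw)
  · rintro c hc z ⟨hz, ε, hε, hεz⟩
    refine ⟨hsmul c hc z hz, ε / (1 + c), by positivity, ?_⟩
    have key : y - (ε / (1 + c)) • c • z = (y - ε • z) + (ε / (1 + c)) • z := by
      have : ε / (1 + c) * c + ε / (1 + c) = ε := by field_simp; ring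
      calc y - (ε / (1 + c)) • c • z
          = (y - (ε / (1 + c) * c + ε / (1 + c)) • z) + (ε / (1 + c)) • z := by module
        _ = _ := by rw [this]
    rw [key]
    exact hadd _ hεz _ (hsmul _ (by positivity) _ hz)
  · rintro z hz w hw ⟨-, ε, hε, hmem⟩
    refine ⟨⟨hz, ε, hε, ?_⟩, ⟨hw, ε, hε, ?_⟩⟩
    · have := hadd _ hmem _ (hsmul ε hε.le w hw)
      rwa [show y - ε • (z + w) + ε • w = y - ε • z by module] at this
    · have := hadd _ hmem _ (hsmul ε hε.le z hz)
      rwa [show y - ε • (z + w) + ε • z = y - ε • w by module] at this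

/-- If a linear map sends `σ` into the cone `σ'`, then some face of `σ'` contains the image of
`σ` and its relative interior contains the image of the relative interior of `σ`. -/
theorem exists_face_image_coneRelint_subset (L : V →ₗ[ℝ] W) {σ : Set V} {σ' : Set W}
    (hσ' : IsConeSet σ') (hne : (coneRelint σ).Nonempty) (hL : L '' σ ⊆ σ') :
    ∃ τ, IsFaceOf τ σ' ∧ L '' σ ⊆ τ ∧ L '' coneRelint σ ⊆ coneRelint τ := by
  obtain ⟨x, hx⟩ := hne
  have hface : IsFaceOf (minFace σ' (L x)) σ' := isFaceOf_minFace hσ' (hL ⟨x, hx.1, rfl⟩)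
  have hsub : L '' σ ⊆ minFace σ' (L x) := by
    rintro _ ⟨s, hs, rfl⟩
    obtain ⟨ε, hε, hmem⟩ := hx.2 s hs
    exact ⟨hL ⟨s, hs, rfl⟩, ε, hε, by simpa using hL ⟨_, hmem, rfl⟩⟩
  refine ⟨minFace σ' (L x), hface, hsub, ?_⟩
  rintro _ ⟨u, hu, rfl⟩
  refine ⟨hsub ⟨u, hu.1, rfl⟩, fun z hz => ?_⟩
  obtain ⟨hzσ, ε, hε, hmem⟩ := hz
  obtain ⟨δ, hδ, hu'⟩ := hu.2 x hx.1
  refine ⟨δ * ε, mul_pos hδ hε, ?_⟩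
  have key : L u - (δ * ε) • z = L (u - δ • x) + δ • (L x - ε • z) := by
    rw [map_sub, map_smul]; module
  rw [key]
  refine hface.1.2.1 _ (hsub ⟨_, hu', rfl⟩) _
    (hface.1.2.2 δ hδ.le _ ⟨hmem, 1, one_pos, ?_⟩)
  rw [show L x - (1 : ℝ) • (L x - ε • z) = ε • z by module]
  exact hσ'.2.2 ε hε.le z hzσ

end Cones

section QuasiFans

variable {N : Type*} [AddCommGroup N]

theorem IsRatCone.coneRelint_nonempty {σ : Set (NR N)} (hσ : IsRatCone σ) :
    (coneRelint σ).Nonempty := by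
  obtain ⟨m, v, rfl⟩ := hσ
  refine ⟨∑ k, (1 : ℝ) • toNR (v k), ⟨fun _ => 1, fun _ => zero_le_one, rfl⟩, ?_⟩
  rintro _ ⟨c, hc, rfl⟩
  have hs : 0 ≤ ∑ k, c k := Finset.sum_nonneg fun k _ => hc k
  refine ⟨1 / (1 + ∑ k, c k), by positivity, fun k => 1 - 1 / (1 + ∑ k, c k) * c k,
    fun k => ?_, ?_⟩
  · have hk : c k ≤ ∑ k, c k := Finset.single_le_sum (fun k _ => hc k) (Finset.mem_univ k)
    rw [sub_nonneg, one_div_mul_eq_div, div_le_one (by positivity)]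
    linarith
  · simp only [Finset.smul_sum, ← Finset.sum_sub_distrib, smul_smul, sub_smul]

theorem IsQuasiFan.isConeSet {Sig : Set (Set (NR N))} (hS : IsQuasiFan Sig) {σ : Set (NR N)}
    (hσ : σ ∈ Sig) : IsConeSet σ := by
  simpa using (hS.2.2.2 σ hσ σ hσ).1.1

/-- Cones of a quasi-fan whose relative interiors meet are equal. -/
theorem IsQuasiFan.eq_of_mem_coneRelint {Sig : Set (Set (NR N))} (hS : IsQuasiFan Sig)
    {σ τ : Set (NR N)} (hσ : σ ∈ Sig) (hτ : τ ∈ Sig) {y : NR N} (hyσ : y ∈ coneRelint σ)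
    (hyτ : y ∈ coneRelint τ) : σ = τ := by
  obtain ⟨h₁, h₂⟩ := hS.2.2.2 σ hσ τ hτ
  have hy : y ∈ σ ∩ τ := ⟨hyσ.1, hyτ.1⟩
  exact (h₁.eq_of_mem_coneRelint (hS.isConeSet hσ) hy hyσ).symm.trans
    (h₂.eq_of_mem_coneRelint (hS.isConeSet hτ) hy hyτ)

end QuasiFans

namespace SysQFan

variable {N N' I I' : Type*} [AddCommGroup N] [AddCommGroup N']

theorem D_subset_left (S : SysQFan N I) (i j : I) : S.D i j ⊆ S.D i i :=
  fun _ hσ => S.inter i j i ⟨hσ, S.symm i j ▸ hσ⟩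

theorem D_subset_right (S : SysQFan N I) (i j : I) : S.D i j ⊆ S.D j j :=
  S.symm i j ▸ S.D_subset_left j i

theorem cls_eq_iff {S : SysQFan N I} {p q : LCone S} :
    cls p = cls q ↔ p.1.1 = q.1.1 ∧ p.1.1 ∈ S.D p.1.2 q.1.2 :=
  Quotient.eq

/-- The labelled cone `q` has label `μ i`, where `i` is the label of `p`, and its cone is the
smallest one containing the image of the cone of `p`. -/
def IsMinImage {S : SysQFan N I} {S' : SysQFan N' I'} (F : N →ₗ[ℤ] N') (μ : I → I')
    (p : LCone S) (q : LCone S') : Prop :=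
  q.1.2 = μ p.1.2 ∧ LinearMap.baseChange ℝ F '' p.1.1 ⊆ q.1.1 ∧
    LinearMap.baseChange ℝ F '' coneRelint p.1.1 ⊆ coneRelint q.1.1

theorem coneRelint_nonempty {S : SysQFan N I} (p : LCone S) : (coneRelint p.1.1).Nonempty :=
  ((S.isQF p.1.2 p.1.2).2.1 _ p.2).coneRelint_nonempty

theorem eq_of_image_coneRelint_subset {S : SysQFan N I} {S' : SysQFan N' I'} {F : N →ₗ[ℤ] N'}
    {p : LCone S} {i j : I'} {σ τ : Set (NR N')} (hσ : σ ∈ S'.D i j) (hτ : τ ∈ S'.D i j)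
    (hpσ : LinearMap.baseChange ℝ F '' coneRelint p.1.1 ⊆ coneRelint σ)
    (hpτ : LinearMap.baseChange ℝ F '' coneRelint p.1.1 ⊆ coneRelint τ) : σ = τ := by
  obtain ⟨x, hx⟩ := coneRelint_nonempty p
  exact (S'.isQF i j).eq_of_mem_coneRelint hσ hτ (hpσ ⟨x, hx, rfl⟩) (hpτ ⟨x, hx, rfl⟩)

theorem exists_face_of_image_subset {S : SysQFan N I} {S' : SysQFan N' I'} (F : N →ₗ[ℤ] N')
    (p : LCone S) {i j : I'} {σ' : Set (NR N')} (hσ' : σ' ∈ S'.D i j)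
    (hF : LinearMap.baseChange ℝ F '' p.1.1 ⊆ σ') :
    ∃ τ ∈ S'.D i j, IsFaceOf τ σ' ∧ LinearMap.baseChange ℝ F '' p.1.1 ⊆ τ ∧
      LinearMap.baseChange ℝ F '' coneRelint p.1.1 ⊆ coneRelint τ := by
  obtain ⟨τ, hτ, h₁, h₂⟩ := exists_face_image_coneRelint_subset (LinearMap.baseChange ℝ F)
    ((S'.isQF i j).isConeSet hσ') (coneRelint_nonempty p) hF
  exact ⟨τ, (S'.isQF i j).2.2.1 _ hσ' _ hτ, hτ, h₁, h₂⟩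

theorem IsMinImage.cls_eq_cls {S : SysQFan N I} {S' : SysQFan N' I'} {F : N →ₗ[ℤ] N'}
    {μ : I → I'}
    (h : ∀ i j, ∀ σ ∈ S.D i j, ∃ σ' ∈ S'.D (μ i) (μ j), LinearMap.baseChange ℝ F '' σ ⊆ σ')
    {p₁ p₂ : LCone S} {q₁ q₂ : LCone S'} (hp : cls p₁ = cls p₂) (h₁ : IsMinImage F μ p₁ q₁)
    (h₂ : IsMinImage F μ p₂ q₂) : cls q₁ = cls q₂ := by
  obtain ⟨heq, hmem⟩ := cls_eq_iff.1 hp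
  obtain ⟨σ', hσ', hF⟩ := h _ _ _ hmem
  obtain ⟨τ, hτ, -, -, hτF⟩ := exists_face_of_image_subset F p₁ hσ' hF
  rw [← h₁.1, ← h₂.1] at hτ
  have e₁ : q₁.1.1 = τ :=
    eq_of_image_coneRelint_subset q₁.2 (S'.D_subset_left _ _ hτ) h₁.2.2 hτF
  have e₂ : q₂.1.1 = τ :=
    eq_of_image_coneRelint_subset q₂.2 (S'.D_subset_right _ _ hτ) h₂.2.2 (heq ▸ hτF)
  exact cls_eq_iff.2 ⟨e₁.trans e₂.symm, e₁ ▸ hτ⟩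

end SysQFan

/-- **Lemma 5.8.**  Let `S`, `S'` be systems of quasi-fans in lattices `N`, `N'`, let
`F : N → N'` be a lattice homomorphism and `μ : I → I'` a map of the index sets such that
for all `i,j` and every `σ ∈ Σ_ij` there is `σ' ∈ Σ'_{μ(i)μ(j)}` with `F_ℝ(σ) ⊆ σ'`.
Then there is a unique map of systems of quasi-fans `(F,𝔣)` from `S` to `S'` such that
`𝔣([σ,i]) ≺ [σ',μ(i)]` for all such `σ`, `σ'`. -/
theorem unique_map_from_index_map
    {N N' : Type} [AddCommGroup N] [Module.Free ℤ N] [Module.Finite ℤ N]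
    [AddCommGroup N'] [Module.Free ℤ N'] [Module.Finite ℤ N']
    {I I' : Type} [Finite I] [Finite I']
    (S : SysQFan N I) (S' : SysQFan N' I')
    (F : N →ₗ[ℤ] N') (μ : I → I')
    (h : ∀ i j, ∀ σ ∈ S.D i j, ∃ σ' ∈ S'.D (μ i) (μ j),
      LinearMap.baseChange ℝ F '' σ ⊆ σ') :
    ∃! f : SysQFan.Omega S → SysQFan.Omega S',
      SysQFan.IsSysMap S S' F f ∧
        ∀ (i j : I) (p : SysQFan.LCone S) (q : SysQFan.LCone S'),
          p.1.2 = i → p.1.1 ∈ S.D i j →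
          q.1.2 = μ i → q.1.1 ∈ S'.D (μ i) (μ j) →
          LinearMap.baseChange ℝ F '' p.1.1 ⊆ q.1.1 →
          SysQFan.le S' (f (SysQFan.cls p)) (SysQFan.cls q) := by
  have exists_minImage (p : SysQFan.LCone S) : ∃ q : SysQFan.LCone S',
      SysQFan.IsMinImage F μ p q := by
    obtain ⟨σ', hσ', hF⟩ := h _ _ _ p.2
    obtain ⟨τ, hτ, -, h₁, h₂⟩ := SysQFan.exists_face_of_image_subset F p hσ' hF
    exact ⟨⟨(τ, μ p.1.2), hτ⟩, rfl, h₁, h₂⟩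
  choose g hg using exists_minImage
  let f : SysQFan.Omega S → SysQFan.Omega S' :=
    Quotient.lift (fun p => SysQFan.cls (g p)) fun p₁ p₂ hp =>
      SysQFan.IsMinImage.cls_eq_cls h (Quotient.sound hp) (hg p₁) (hg p₂)
  have hf {p : SysQFan.LCone S} {q : SysQFan.LCone S'} (hq : SysQFan.IsMinImage F μ p q) :
      f (SysQFan.cls p) = SysQFan.cls q :=
    SysQFan.IsMinImage.cls_eq_cls h rfl (hg p) hq
  refine ⟨f, ⟨⟨?_, fun p q hpq => ?_⟩, ?_⟩, ?_⟩
  · rintro _ _ ⟨p, q, rfl, rfl, hface, hmem⟩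
    let p' : SysQFan.LCone S := ⟨(p.1.1, q.1.2), S.D_subset_right _ _ hmem⟩
    have hp : SysQFan.cls p = SysQFan.cls p' := SysQFan.cls_eq_iff.2 ⟨rfl, hmem⟩
    obtain ⟨τ, hτ, hτq, h₁, h₂⟩ := SysQFan.exists_face_of_image_subset F p' (g q).2
      ((Set.image_mono hface.2.1).trans (hg q).2.1)
    rw [hp, hf (p := p') (q := ⟨(τ, (g q).1.2), hτ⟩) ⟨(hg q).1, h₁, h₂⟩]
    exact ⟨_, _, rfl, rfl, hτq, hτ⟩
  · rw [← (SysQFan.cls_eq_iff.1 ((hf (hg p)).symm.trans hpq)).1]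
    exact (hg p).2.2
  · rintro _ - p q rfl - hqi - hF
    obtain ⟨τ, hτ, hτq, h₁, h₂⟩ := SysQFan.exists_face_of_image_subset F p q.2 hF
    rw [hf (q := ⟨(τ, q.1.2), hτ⟩) ⟨hqi, h₁, h₂⟩]
    exact ⟨_, _, rfl, rfl, hτq, hτ⟩
  · rintro f' ⟨⟨-, hrel⟩, hle⟩
    funext a
    obtain ⟨p, rfl⟩ := Quotient.exists_rep a
    obtain ⟨t, u, ht, hu, -, hmem⟩ := hle _ p.1.2 p (g p) rfl p.2 (hg p).1
      ((hg p).1 ▸ (g p).2) (hg p).2.1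
    have htu : t.1.1 = u.1.1 := SysQFan.eq_of_image_coneRelint_subset
      (S'.D_subset_right _ _ hmem) u.2 (hrel p t ht.symm)
      ((SysQFan.cls_eq_iff.1 hu).1 ▸ (hg p).2.2)
    exact (ht.symm.trans (SysQFan.cls_eq_iff.2 ⟨htu, hmem⟩)).trans hu
end
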